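/- Difference-in-differences setting with two periods t ∈ {1, 2}: let Y_t(0), Y_t(1) : Ω → {0, 1} be period-t potential outcomes with realized outcome Y_t := D·Y_t(1) + (1 − D)·Y_t(0), and let R_1, R_2 : Ω → ℛ be period-specific remotely sensed variables. Suppose: (Overlap) 0 < P(D = 1) < 1; (Parallel trends) E[Y_2(0) − Y_1(0) | S = e, D = 1] = E[Y_2(0) − Y_1(0) | S = e, D = 0]; (No anticipation) P(Y_1(0) = Y_1(1) | S = e, D = 1) = 1; and for each t ∈ {1, 2}: (Positivity) P(S = e, D = d, Y_t = y) > 0 and P(S = o, Y_t = y) > 0 for all d, y ∈ {0, 1}; (Stability) R_t is conditionally independent of S given (D, Y_t); (No direct effect) R_t is conditionally independent of D given Y_t. Then for every t ∈ {1, 2} and d ∈ {0, 1}, writing α_t(d) := E[Y_t | S = e, D = d], Δ_t^e(d) := 1{D = d, S = e}/P(D = d, S = e) − 1{Y_t = 0, S = o}/P(Y_t = 0, S = o) and Δ_t^o := 1{Y_t = 1, S = o}/P(Y_t = 1, S = o) − 1{Y_t = 0, S = o}/P(Y_t = 0, S = o), the conditional expectation of Δ_t^e(d) − α_t(d)·Δ_t^o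 given σ(R_t) equals 0 P-almost surely; equivalently α_t(d) = E[Δ_t^e(d) | σ(R_t)] / E[Δ_t^o | σ(R_t)] almost surely on the event {E[Δ_t^o | σ(R_t)] ≠ 0}. -/

import Mathlib

open MeasureTheory ProbabilityTheory

noncomputable section

/-- Sample indicator values: experimental (`e`) or observational (`o`). -/
inductive Sample : Type
  | e
  | o
deriving DecidableEq

instance : MeasurableSpace Sample := ⊤

/-- Real-valued indicator of a boolean (`{0,1}`-valued variable). -/
def b2r (b : Bool) : ℝ := if b then 1 else 0

/-- `CondIndepOf P R V W` : the conditional law of `R` given `V = v, W = w` agrees with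
the conditional law of `R` given `V = v`, for all values with positive probability;
this is the notion of "R is conditionally independent of W given V" for variables with
countable ranges. -/
def CondIndepOf {Ω 𝓡 V W : Type*} [MeasurableSpace Ω] [MeasurableSpace 𝓡]
    (P : Measure Ω) (R : Ω → 𝓡) (Vf : Ω → V) (Wf : Ω → W) : Prop :=
  ∀ v w, 0 < P {ω | Vf ω = v ∧ Wf ω = w} →
    (P[|{ω | Vf ω = v ∧ Wf ω = w}]).map R = (P[|{ω | Vf ω = v}]).map R

lemma cond_real_eq_div {Ω : Type*} [MeasurableSpace Ω] (P : Measure Ω) {A : Set Ω}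
    (hA : MeasurableSet A) (T : Set Ω) : (P[|A]).real T = P.real (A ∩ T) / P.real A := by
  simp [measureReal_def, cond_apply hA, div_eq_inv_mul]

/-- Under conditional independence of `R` and `W` given `V`, the conditional probability of
`R ∈ B` does not depend on the value of `W`. -/
lemma CondIndepOf.cond_real_preimage {Ω 𝓡 V W : Type*} [MeasurableSpace Ω] [MeasurableSpace 𝓡]
    {P : Measure Ω} {R : Ω → 𝓡} {Vf : Ω → V} {Wf : Ω → W} (h : CondIndepOf P R Vf Wf)
    (hR : Measurable R) {B : Set 𝓡} (hB : MeasurableSet B) {v : V} {w : W}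
    (hvw : 0 < P {ω | Vf ω = v ∧ Wf ω = w}) :
    (P[|{ω | Vf ω = v ∧ Wf ω = w}]).real (R ⁻¹' B) = (P[|{ω | Vf ω = v}]).real (R ⁻¹' B) := by
  rw [← map_measureReal_apply hR hB, ← map_measureReal_apply hR hB, h v w hvw]

/-- If `R` is independent of `S` given `(D, Y)` and of `D` given `Y`, then within every cell of
`(S, D, Y)` the variable `R` follows its conditional law given `Y`. -/
lemma CondIndepOf.measureReal_cell_inter {Ω 𝓡 U V W : Type*} [MeasurableSpace Ω]
    [MeasurableSpace 𝓡] [MeasurableSpace U] [MeasurableSpace V] [MeasurableSpace W]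
    [MeasurableSingletonClass U] [MeasurableSingletonClass V] [MeasurableSingletonClass W]
    {P : Measure Ω} [IsFiniteMeasure P] {R : Ω → 𝓡} {S : Ω → U} {D : Ω → V} {Y : Ω → W}
    (hS : Measurable S) (hD : Measurable D) (hY : Measurable Y) (hR : Measurable R)
    (h₁ : CondIndepOf P R (fun ω => (D ω, Y ω)) S) (h₂ : CondIndepOf P R Y D)
    {B : Set 𝓡} (hB : MeasurableSet B) (s : U) (d : V) (y : W) :
    P.real ((S ⁻¹' {s} ∩ D ⁻¹' {d} ∩ Y ⁻¹' {y}) ∩ R ⁻¹' B) =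
      P.real (S ⁻¹' {s} ∩ D ⁻¹' {d} ∩ Y ⁻¹' {y}) * (P[|{ω | Y ω = y}]).real (R ⁻¹' B) := by
  set A := S ⁻¹' {s} ∩ D ⁻¹' {d} ∩ Y ⁻¹' {y} with hA
  have hAm : MeasurableSet A :=
    ((hS (measurableSet_singleton s)).inter (hD (measurableSet_singleton d))).inter
      (hY (measurableSet_singleton y))
  rcases eq_or_ne (P A) 0 with h0 | h0
  · have h0' : P.real A = 0 := by simp [measureReal_def, h0]
    rw [h0', zero_mul]
    exact le_antisymm ((measureReal_mono Set.inter_subset_left).trans h0'.le)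
      measureReal_nonneg
  · have e₁ : {ω | (fun ω => (D ω, Y ω)) ω = (d, y) ∧ S ω = s} = A := by
      ext ω; simp [hA]; tauto
    have e₂ : {ω | (fun ω => (D ω, Y ω)) ω = (d, y)} = {ω | Y ω = y ∧ D ω = d} := by
      ext ω; simp; tauto
    have k₁ := h₁.cond_real_preimage hR hB (v := (d, y)) (w := s)
      (by rw [e₁]; exact pos_iff_ne_zero.mpr h0)
    have k₂ := h₂.cond_real_preimage hR hB (v := y) (w := d) (by
      refine (pos_iff_ne_zero.mpr h0).trans_le (measure_mono fun ω hω => ?_)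
      exact ⟨hω.2, hω.1.2⟩)
    rw [e₁, e₂, k₂] at k₁
    have hpos : P.real A ≠ 0 := (measureReal_ne_zero_iff).mpr h0
    rw [← k₁, cond_real_eq_div P hAm, mul_div_cancel₀ _ hpos]

/-- Splitting the measure of a set along a Boolean variable. -/
lemma measureReal_eq_add_preimage_bool {Ω : Type*} [MeasurableSpace Ω] (P : Measure Ω)
    [IsFiniteMeasure P] {Z : Ω → Bool} (hZ : Measurable Z) (A : Set Ω) :
    P.real A = P.real (A ∩ Z ⁻¹' {true}) + P.real (A ∩ Z ⁻¹' {false}) := by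
  rw [← measureReal_inter_add_sdiff (hZ (measurableSet_singleton true))]
  congr 2
  ext ω; simp

lemma setIntegral_indicator_one_div {Ω : Type*} [MeasurableSpace Ω] (P : Measure Ω)
    {A : Set Ω} (hA : MeasurableSet A) (T : Set Ω) (c : ℝ) :
    ∫ ω in T, A.indicator 1 ω / c ∂P = P.real (A ∩ T) / c := by
  rw [integral_div, integral_indicator_one hA, measureReal_restrict_apply hA]

lemma integrable_indicator_one_div {Ω : Type*} [MeasurableSpace Ω] (P : Measure Ω)
    [IsFiniteMeasure P] {A : Set Ω} (hA : MeasurableSet A) (c : ℝ) :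
    Integrable (fun ω => A.indicator 1 ω / c) P :=
  ((integrable_const (1 : ℝ)).indicator hA).div_const c

lemma integral_b2r {Ω : Type*} [MeasurableSpace Ω] (P : Measure Ω) {Z : Ω → Bool}
    (hZ : Measurable Z) : ∫ ω, b2r (Z ω) ∂P = P.real (Z ⁻¹' {true}) := by
  rw [← integral_indicator_one (hZ (measurableSet_singleton true))]
  congr 1 with ω
  simp [b2r, Set.indicator]

/-- **Theorem (Identification for difference-in-differences).** Periods are indexed by
`Fin 2` (period 1 = `0`, period 2 = `1`). For every period `t` and `d ∈ {0,1}`,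
`E[Δ_t^e(d) − α_t(d)·Δ_t^o | σ(R_t)] = 0` `P`-a.s.; equivalently
`α_t(d) = E[Δ_t^e(d)|σ(R_t)] / E[Δ_t^o|σ(R_t)]` a.s. on `{E[Δ_t^o|σ(R_t)] ≠ 0}`. -/
theorem statement19
    {Ω 𝓡 : Type*} [MeasurableSpace Ω] [MeasurableSpace 𝓡] [StandardBorelSpace 𝓡]
    (P : Measure Ω) [IsProbabilityMeasure P]
    (S : Ω → Sample) (D : Ω → Bool)
    -- Yp t d = period-t potential outcome under treatment d
    (Yp : Fin 2 → Bool → Ω → Bool)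
    (R : Fin 2 → Ω → 𝓡)
    (hS : Measurable S) (hD : Measurable D)
    (hYp : ∀ t d, Measurable (Yp t d)) (hR : ∀ t, Measurable (R t))
    -- Realized outcomes: Y_t := D·Y_t(1) + (1 − D)·Y_t(0)
    (Y : Fin 2 → Ω → Bool)
    (hYdef : ∀ t ω, Y t ω = if D ω then Yp t true ω else Yp t false ω)
    -- Overlap: 0 < P(D = 1) < 1
    (overlap₀ : 0 < P {ω | D ω = true}) (overlap₁ : P {ω | D ω = true} < 1)
    -- Parallel trends: E[Y₂(0) − Y₁(0) | S = e, D = 1] = E[Y₂(0) − Y₁(0) | S = e, D = 0]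
    (parallelTrends :
      (∫ ω, (b2r (Yp 1 false ω) - b2r (Yp 0 false ω))
        ∂(P[|{ω | S ω = Sample.e ∧ D ω = true}])) =
      (∫ ω, (b2r (Yp 1 false ω) - b2r (Yp 0 false ω))
        ∂(P[|{ω | S ω = Sample.e ∧ D ω = false}])))
    -- No anticipation: P(Y₁(0) = Y₁(1) | S = e, D = 1) = 1
    (noAnticipation :
      (P[|{ω | S ω = Sample.e ∧ D ω = true}]) {ω | Yp 0 false ω = Yp 0 true ω} = 1)
    -- Positivity, for each period
    (positivity_e : ∀ (t : Fin 2) (d y : Bool),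
      0 < P {ω | S ω = Sample.e ∧ D ω = d ∧ Y t ω = y})
    (positivity_o : ∀ (t : Fin 2) (y : Bool),
      0 < P {ω | S ω = Sample.o ∧ Y t ω = y})
    -- Stability: R_t ⫫ S | (D, Y_t)
    (stability : ∀ t : Fin 2, CondIndepOf P (R t) (fun ω => (D ω, Y t ω)) S)
    -- No direct effect: R_t ⫫ D | Y_t
    (noDirectEffect : ∀ t : Fin 2, CondIndepOf P (R t) (Y t) D)
    -- α_t(d) := E[Y_t | S = e, D = d]
    (α : Fin 2 → Bool → ℝ)
    (hα : ∀ t d, α t d =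
      ∫ ω, b2r (Y t ω) ∂(P[|{ω | S ω = Sample.e ∧ D ω = d}]))
    -- Δ_t^e(d) := 1{D=d,S=e}/P(D=d,S=e) − 1{Y_t=0,S=o}/P(Y_t=0,S=o)
    (Δe : Fin 2 → Bool → Ω → ℝ)
    (hΔe : ∀ t d ω, Δe t d ω =
      (if D ω = d ∧ S ω = Sample.e then (1 : ℝ) else 0) /
        (P {ω' | D ω' = d ∧ S ω' = Sample.e}).toReal -
      (if Y t ω = false ∧ S ω = Sample.o then (1 : ℝ) else 0) /
        (P {ω' | Y t ω' = false ∧ S ω' = Sample.o}).toReal)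
    -- Δ_t^o := 1{Y_t=1,S=o}/P(Y_t=1,S=o) − 1{Y_t=0,S=o}/P(Y_t=0,S=o)
    (Δo : Fin 2 → Ω → ℝ)
    (hΔo : ∀ t ω, Δo t ω =
      (if Y t ω = true ∧ S ω = Sample.o then (1 : ℝ) else 0) /
        (P {ω' | Y t ω' = true ∧ S ω' = Sample.o}).toReal -
      (if Y t ω = false ∧ S ω = Sample.o then (1 : ℝ) else 0) /
        (P {ω' | Y t ω' = false ∧ S ω' = Sample.o}).toReal) :
    ∀ (t : Fin 2) (d : Bool),
      (P[(fun ω => Δe t d ω - α t d * Δo t ω) |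
          MeasurableSpace.comap (R t) inferInstance]
        =ᵐ[P] 0) ∧
      (∀ᵐ ω ∂P,
        (P[(Δo t) | MeasurableSpace.comap (R t) inferInstance]) ω ≠ 0 →
        α t d = (P[(Δe t d) | MeasurableSpace.comap (R t) inferInstance]) ω /
          (P[(Δo t) | MeasurableSpace.comap (R t) inferInstance]) ω) := by
  intro t d
  have hY : Measurable (Y t) := by
    have : Y t = fun ω => if D ω = true then Yp t true ω else Yp t false ω :=
      funext (hYdef t)
    rw [this]
    exact Measurable.ite (hD (measurableSet_singleton true)) (hYp t true) (hYp t false)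
  set E : Set Ω := {ω | D ω = d ∧ S ω = Sample.e} with hE
  set O : Bool → Set Ω := fun y => {ω | Y t ω = y ∧ S ω = Sample.o} with hO
  have hEm : MeasurableSet E :=
    (hD (measurableSet_singleton d)).inter (hS (measurableSet_singleton Sample.e))
  have hOm (y : Bool) : MeasurableSet (O y) :=
    (hY (measurableSet_singleton y)).inter (hS (measurableSet_singleton Sample.o))
  have hEpos : 0 < P.real E := by
    refine ENNReal.toReal_pos (((positivity_e t d true).trans_le
      (measure_mono fun ω hω => ?_)).ne') (measure_ne_top _ _)
    exact ⟨hω.2.1, hω.1⟩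
  have hOpos (y : Bool) : 0 < P.real (O y) := by
    refine ENNReal.toReal_pos (((positivity_o t y).trans_le
      (measure_mono fun ω hω => ?_)).ne') (measure_ne_top _ _)
    exact ⟨hω.2, hω.1⟩
  have hOinter {B : Set 𝓡} (hB : MeasurableSet B) (y : Bool) :
      P.real (O y ∩ R t ⁻¹' B) =
        P.real (O y) * (P[|{ω | Y t ω = y}]).real (R t ⁻¹' B) := by
    have key (d' : Bool) := (stability t).measureReal_cell_inter hS hD hY (hR t)
      (noDirectEffect t) hB Sample.o d' y
    have e₁ (d' : Bool) : O y ∩ R t ⁻¹' B ∩ D ⁻¹' {d'} =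
        (S ⁻¹' {Sample.o} ∩ D ⁻¹' {d'} ∩ Y t ⁻¹' {y}) ∩ R t ⁻¹' B := by
      ext ω; simp [hO]; tauto
    have e₂ (d' : Bool) : O y ∩ D ⁻¹' {d'} =
        S ⁻¹' {Sample.o} ∩ D ⁻¹' {d'} ∩ Y t ⁻¹' {y} := by
      ext ω; simp [hO]; tauto
    rw [measureReal_eq_add_preimage_bool P hD (O y ∩ _),
      measureReal_eq_add_preimage_bool P hD (O y)]
    simp only [e₁, e₂, key]
    ring
  have e₃ (y : Bool) : E ∩ Y t ⁻¹' {y} = S ⁻¹' {Sample.e} ∩ D ⁻¹' {d} ∩ Y t ⁻¹' {y} := by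
    ext ω; simp [hE]; tauto
  have hEinter {B : Set 𝓡} (hB : MeasurableSet B) : P.real (E ∩ R t ⁻¹' B) =
      P.real (E ∩ Y t ⁻¹' {true}) * (P[|{ω | Y t ω = true}]).real (R t ⁻¹' B) +
      P.real (E ∩ Y t ⁻¹' {false}) * (P[|{ω | Y t ω = false}]).real (R t ⁻¹' B) := by
    have key (y : Bool) := (stability t).measureReal_cell_inter hS hD hY (hR t)
      (noDirectEffect t) hB Sample.e d y
    rw [measureReal_eq_add_preimage_bool P hY (E ∩ _)]
    simp only [Set.inter_right_comm E (R t ⁻¹' B), e₃, key]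
  have hα' : α t d = P.real (E ∩ Y t ⁻¹' {true}) / P.real E := by
    have : {ω | S ω = Sample.e ∧ D ω = d} = E := by ext ω; simp [hE]; tauto
    rw [hα, integral_b2r _ hY, this, cond_real_eq_div P hEm]
  have hEsplit := measureReal_eq_add_preimage_bool P hY E
  have hΔe' : Δe t d = fun ω => E.indicator 1 ω / P.real E -
      (O false).indicator 1 ω / P.real (O false) := by
    ext ω; rw [hΔe]; simp [hE, hO, measureReal_def, Set.indicator]
  have hΔo' : Δo t = fun ω => (O true).indicator 1 ω / P.real (O true) -
      (O false).indicator 1 ω / P.real (O false) := by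
    ext ω; rw [hΔo]; simp [hO, measureReal_def, Set.indicator]
  have ie : Integrable (Δe t d) P := by
    rw [hΔe']
    exact Integrable.sub (integrable_indicator_one_div P hEm _) (integrable_indicator_one_div P (hOm _) _)
  have io : Integrable (Δo t) P := by
    rw [hΔo']
    exact Integrable.sub (integrable_indicator_one_div P (hOm _) _) (integrable_indicator_one_div P (hOm _) _)
  have hm : MeasurableSpace.comap (R t) inferInstance ≤ (inferInstance : MeasurableSpace Ω) :=
    (hR t).comap_le
  have hzero : P[(fun ω => Δe t d ω - α t d * Δo t ω) |
      MeasurableSpace.comap (R t) inferInstance] =ᵐ[P] 0 := by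
    refine (ae_eq_condExp_of_forall_setIntegral_eq hm (ie.sub (io.const_mul _)) ?_ ?_ ?_).symm
    · intro s _ _
      exact integrableOn_zero
    · rintro _ ⟨B, hB, rfl⟩ -
      change _ = ∫ ω in R t ⁻¹' B, (Δe t d ω - α t d * Δo t ω) ∂P
      rw [integral_sub ie.integrableOn (io.const_mul _).integrableOn, integral_const_mul,
        hΔe', hΔo']
      beta_reduce
      rw [integral_sub (integrable_indicator_one_div P hEm _).integrableOn
          (integrable_indicator_one_div P (hOm _) _).integrableOn,
        integral_sub (integrable_indicator_one_div P (hOm _) _).integrableOn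
          (integrable_indicator_one_div P (hOm _) _).integrableOn,
        setIntegral_indicator_one_div P hEm, setIntegral_indicator_one_div P (hOm _), setIntegral_indicator_one_div P (hOm _),
        hOinter hB, hOinter hB, hEinter hB, hα',
        mul_div_cancel_left₀ _ (hOpos _).ne', mul_div_cancel_left₀ _ (hOpos _).ne']
      have hfalse : P.real (E ∩ Y t ⁻¹' {false}) = P.real E - P.real (E ∩ Y t ⁻¹' {true}) := by
        linarith
      rw [hfalse]
      simp only [Pi.zero_apply, integral_zero]
      have := hEpos.ne'
      field_simp
      ring
    · exact stronglyMeasurable_zero.aestronglyMeasurable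
  refine ⟨hzero, ?_⟩
  filter_upwards [hzero, condExp_sub ie (io.const_mul (α t d))
      (MeasurableSpace.comap (R t) inferInstance),
    condExp_smul (μ := P) (α t d) (Δo t) (MeasurableSpace.comap (R t) inferInstance)]
    with ω h₀ h₁ h₂ hne
  rw [eq_div_iff hne]
  have h₃ := h₁.symm.trans h₀
  simp only [Pi.sub_apply, Pi.zero_apply] at h₃
  simpa using h₂.symm.trans (sub_eq_zero.mp h₃).symm
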